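/- arXiv:2509.08117 — 3 statements merged into one kernel-verified Lean document; each statement's English description precedes it below -/
import Mathlib

section
/- Let (Ω, P) be a probability space, I a nonempty finite index set, δ ∈ (0,1], and (π_t)_{t≥1} positive reals with Σ_{t≥1} 1/π_t = 1. For each t ≥ 1 set β_t = 2·log(|I|·π_t/δ). Suppose for each t ≥ 1 and x ∈ I, f_{t,x} : Ω → ℝ is a random variable whose law is the Gaussian measure with mean μ_{t,x} ∈ ℝ and variance σ_{t,x}² with σ_{t,x} > 0. Then P(∀ t ≥ 1, ∀ x ∈ I, |f_{t,x} − μ_{t,x}| ≤ √(β_t) · σ_{t,x}) ≥ 1 − δ. -/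
open MeasureTheory ProbabilityTheory

open scoped NNReal

lemma gaussianReal_Ioi_le {v : ℝ≥0} (hv : v ≠ 0) {c : ℝ} (hc : 0 ≤ c) :
    gaussianReal 0 v (Set.Ioi c) ≤
      ENNReal.ofReal (Real.exp (-c ^ 2 / (2 * v))) * gaussianReal 0 v (Set.Ioi 0) := by
  have hshift : gaussianReal 0 v (Set.Ioi c) = gaussianReal (-c) v (Set.Ioi 0) := by
    rw [← zero_sub c, ← gaussianReal_map_sub_const c,
      Measure.map_apply (by fun_prop) measurableSet_Ioi]
    simp
  rw [hshift, gaussianReal_apply _ hv, gaussianReal_apply _ hv,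
    ← lintegral_const_mul _ (by fun_prop)]
  refine setLIntegral_mono (by fun_prop) fun y hy ↦ ?_
  rw [gaussianPDF, gaussianPDF, ← ENNReal.ofReal_mul (by positivity)]
  refine ENNReal.ofReal_le_ofReal ?_
  rw [gaussianPDFReal, gaussianPDFReal, mul_left_comm, ← Real.exp_add, ← add_div]
  have hyc : 0 ≤ y * c := mul_nonneg (Set.mem_Ioi.mp hy).le hc
  gcongr
  nlinarith

lemma gaussianReal_Iio_neg (v : ℝ≥0) (c : ℝ) :
    gaussianReal 0 v (Set.Iio (-c)) = gaussianReal 0 v (Set.Ioi c) := by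
  have h := gaussianReal_map_neg (μ := 0) (v := v)
  rw [neg_zero] at h
  conv_lhs => rw [← h, Measure.map_apply measurable_neg measurableSet_Iio]
  simp

lemma gaussianReal_abs_gt_le {v : ℝ≥0} (hv : v ≠ 0) {c : ℝ} (hc : 0 ≤ c) :
    gaussianReal 0 v {x | c < |x|} ≤ ENNReal.ofReal (Real.exp (-c ^ 2 / (2 * v))) := by
  have hset : {x : ℝ | c < |x|} = Set.Ioi c ∪ Set.Iio (-c) := by
    ext x
    simp [lt_abs, lt_neg]
  have hhalf : gaussianReal 0 v (Set.Ioi 0) + gaussianReal 0 v (Set.Ioi 0) ≤ 1 := by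
    conv_lhs => enter [2]; rw [← gaussianReal_Iio_neg, neg_zero]
    rw [← measure_union Set.Ioi_disjoint_Iio_same measurableSet_Iio]
    exact prob_le_one
  calc gaussianReal 0 v {x | c < |x|}
      ≤ gaussianReal 0 v (Set.Ioi c) + gaussianReal 0 v (Set.Ioi c) := by
        rw [hset]
        exact (measure_union_le _ _).trans_eq (by rw [gaussianReal_Iio_neg])
    _ ≤ ENNReal.ofReal (Real.exp (-c ^ 2 / (2 * v))) *
          (gaussianReal 0 v (Set.Ioi 0) + gaussianReal 0 v (Set.Ioi 0)) := by
        rw [mul_add]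
        exact add_le_add (gaussianReal_Ioi_le hv hc) (gaussianReal_Ioi_le hv hc)
    _ ≤ ENNReal.ofReal (Real.exp (-c ^ 2 / (2 * v))) := mul_le_of_le_one_right' hhalf

lemma measure_abs_sub_gt_le_of_map_eq_gaussianReal {Ω : Type*} [MeasurableSpace Ω]
    {P : Measure Ω} {X : Ω → ℝ} {m : ℝ} {v : ℝ≥0} (hv : v ≠ 0)
    (hX : P.map X = gaussianReal m v) {c : ℝ} (hc : 0 ≤ c) :
    P {ω | c < |X ω - m|} ≤ ENNReal.ofReal (Real.exp (-c ^ 2 / (2 * v))) := by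
  have hXm : AEMeasurable X P :=
    AEMeasurable.of_map_ne_zero (hX ▸ IsProbabilityMeasure.ne_zero (gaussianReal m v))
  have hlaw : P.map (fun ω ↦ X ω - m) = gaussianReal 0 v := by
    have h := gaussianReal_map_sub_const (μ := m) (v := v) m
    rw [sub_self, ← hX, AEMeasurable.map_map_of_aemeasurable (by fun_prop) hXm] at h
    exact h
  have hmeas : MeasurableSet {x : ℝ | c < |x|} :=
    measurableSet_lt measurable_const measurable_id.abs
  refine le_trans (le_of_eq ?_) (gaussianReal_abs_gt_le hv hc)
  rw [← hlaw, Measure.map_apply_of_aemeasurable (by fun_prop) hmeas]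
  rfl

/-- Lemma 1 of the paper: uniform Gaussian confidence bound over a finite domain `I`
and countably many time steps `t ≥ 1`. With `β t = 2·log(|I|·π t/δ)` and
`Σ_t 1/π t = 1`, the event `∀ t, ∀ x, |f t x − μ t x| ≤ √(β t) · σ t x` has
probability at least `1 − δ`. -/
theorem gp_uniform_confidence_bound
    {Ω : Type*} [MeasurableSpace Ω] (P : Measure Ω) [IsProbabilityMeasure P]
    {I : Type*} [Fintype I] [Nonempty I]
    (δ : ℝ) (hδ0 : 0 < δ) (hδ1 : δ ≤ 1)
    (π : ℕ+ → ℝ) (hπ : ∀ t, 0 < π t) (hπsum : ∑' t : ℕ+, 1 / π t = 1)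
    (β : ℕ+ → ℝ) (hβ : ∀ t, β t = 2 * Real.log (Fintype.card I * π t / δ))
    (f : ℕ+ → I → Ω → ℝ) (μ : ℕ+ → I → ℝ) (σ : ℕ+ → I → ℝ)
    (hσ : ∀ t x, 0 < σ t x)
    (hlaw : ∀ t x, P.map (f t x) = gaussianReal (μ t x) (⟨(σ t x) ^ 2, sq_nonneg _⟩ : NNReal)) :
    ENNReal.ofReal (1 - δ)
      ≤ P {ω | ∀ t : ℕ+, ∀ x : I, |f t x ω - μ t x| ≤ Real.sqrt (β t) * σ t x} := by
  have hsummable : Summable fun t : ℕ+ ↦ 1 / π t := by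
    by_contra h
    rw [tsum_eq_zero_of_not_summable h] at hπsum
    exact zero_ne_one hπsum
  have hcard : (1 : ℝ) ≤ Fintype.card I := by exact_mod_cast Fintype.card_pos
  have hπ_one (t : ℕ+) : 1 ≤ π t := by
    have h := hsummable.le_tsum t fun s _ ↦ (one_div_pos.mpr (hπ s)).le
    rw [hπsum, div_le_one (hπ t)] at h
    exact h
  have hβ_nonneg (t : ℕ+) : 0 ≤ β t := by
    rw [hβ]
    have : 1 ≤ Fintype.card I * π t / δ := by
      rw [le_div_iff₀ hδ0, one_mul]
      exact hδ1.trans (one_le_mul_of_one_le_of_one_le hcard (hπ_one t))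
    have := Real.log_nonneg this
    positivity
  have htail (t : ℕ+) (x : I) :
      P {ω | Real.sqrt (β t) * σ t x < |f t x ω - μ t x|} ≤
        ENNReal.ofReal (δ / (Fintype.card I * π t)) := by
    have hσ' := hσ t x
    have hπ' := hπ t
    refine (measure_abs_sub_gt_le_of_map_eq_gaussianReal ?_ (hlaw t x) (by positivity)).trans_eq ?_
    · exact fun h ↦ (pow_pos hσ' 2).ne' (congrArg NNReal.toReal h)
    · congr 1
      have hexp : -(Real.sqrt (β t) * σ t x) ^ 2 / (2 * σ t x ^ 2) =
          -Real.log (Fintype.card I * π t / δ) := by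
        rw [mul_pow, Real.sq_sqrt (hβ_nonneg t), hβ]
        field_simp
      refine (congrArg Real.exp hexp).trans ?_
      rw [Real.exp_neg, Real.exp_log (by positivity), inv_div]
  set A := {ω | ∀ t : ℕ+, ∀ x : I, |f t x ω - μ t x| ≤ Real.sqrt (β t) * σ t x} with hA
  have hAc : P Aᶜ ≤ ENNReal.ofReal δ := by
    have hset : Aᶜ = ⋃ t, ⋃ x, {ω | Real.sqrt (β t) * σ t x < |f t x ω - μ t x|} := by
      ext ω
      simp [hA]
    calc P Aᶜ
        ≤ ∑' t, ∑ x, P {ω | Real.sqrt (β t) * σ t x < |f t x ω - μ t x|} := by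
          rw [hset]
          exact (measure_iUnion_le _).trans
            (ENNReal.tsum_le_tsum fun t ↦ measure_iUnion_fintype_le _ _)
      _ ≤ ∑' t : ℕ+, ENNReal.ofReal (δ * (1 / π t)) := by
          refine ENNReal.tsum_le_tsum fun t ↦
            (Finset.sum_le_sum fun x _ ↦ htail t x).trans_eq ?_
          have hπ' := hπ t
          rw [Finset.sum_const, Finset.card_univ, ← ENNReal.ofReal_nsmul, nsmul_eq_mul]
          congr 1
          field_simp
      _ = ENNReal.ofReal δ := by
          rw [← ENNReal.ofReal_tsum_of_nonneg
            (fun t ↦ mul_nonneg hδ0.le (one_div_pos.mpr (hπ t)).le) (hsummable.mul_left δ),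
            tsum_mul_left, hπsum, mul_one]
  rw [ENNReal.ofReal_sub _ hδ0.le, ENNReal.ofReal_one, tsub_le_iff_right]
  calc 1 = P (A ∪ Aᶜ) := by rw [Set.union_compl_self, measure_univ]
    _ ≤ P A + P Aᶜ := measure_union_le _ _
    _ ≤ P A + ENNReal.ofReal δ := by gcongr
end

section
/- Let Q be a nonempty finite subset of ℝ², n ≥ 1, and for a density g : Q → ℝ and positions x = (x¹,…,xⁿ) ∈ Qⁿ define the locational cost ℓ(g, x) = Σ_{q ∈ Q} (min_{1≤i≤n} ‖q − xⁱ‖²) · g(q). Let f, f̂ : Q → ℝ, s : Q → ℝ with s(q) ≥ 0, and b ≥ 0 satisfy f̂(q) ≤ f(q) ≤ f̂(q) + 2b·s(q) for all q ∈ Q. Suppose x̂ ∈ Qⁿ minimizes ℓ(f̂, ·) over Qⁿ. Then for every x* ∈ Qⁿ, ℓ(f, x̂) − ℓ(f, x*) ≤ 2·b·c₀·max_{q∈Q} s(q), where c₀ = |Q| · max_{q,q'∈Q} ‖q − q'‖². -/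
open scoped BigOperators

/-- The locational cost of a density `g` on a finite discretized domain `Q ⊂ ℝ²` at robot
positions `x : Fin n → ℝ²`: `ℓ(g, x) = Σ_{q ∈ Q} (min_i ‖q − xⁱ‖²) · g(q)`. -/
noncomputable def locCost {n : ℕ} (hn : 0 < n) (Q : Finset (EuclideanSpace ℝ (Fin 2)))
    (g : EuclideanSpace ℝ (Fin 2) → ℝ) (x : Fin n → EuclideanSpace ℝ (Fin 2)) : ℝ :=
  ∑ q ∈ Q, (Finset.univ.inf' (Finset.univ_nonempty_iff.mpr ⟨⟨0, hn⟩⟩)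
    fun i => ‖q - x i‖ ^ 2) * g q

theorem locCost_mono_density {n : ℕ} (hn : 0 < n) (Q : Finset (EuclideanSpace ℝ (Fin 2)))
    {g h : EuclideanSpace ℝ (Fin 2) → ℝ} (hgh : ∀ q ∈ Q, g q ≤ h q)
    (x : Fin n → EuclideanSpace ℝ (Fin 2)) : locCost hn Q g x ≤ locCost hn Q h x :=
  Finset.sum_le_sum fun q hq =>
    mul_le_mul_of_nonneg_left (hgh q hq) (Finset.le_inf' _ _ fun _ _ => sq_nonneg _)

theorem locCost_sub_le {n : ℕ} (hn : 0 < n) (Q : Finset (EuclideanSpace ℝ (Fin 2)))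
    (hQ : Q.Nonempty) {g h : EuclideanSpace ℝ (Fin 2) → ℝ} {C : ℝ} (hC : 0 ≤ C)
    (hgh : ∀ q ∈ Q, g q - h q ≤ C)
    {x : Fin n → EuclideanSpace ℝ (Fin 2)} (hx : ∀ i, x i ∈ Q) :
    locCost hn Q g x - locCost hn Q h x
      ≤ (Q.card : ℝ) * Q.sup' hQ (fun q => Q.sup' hQ fun q' => ‖q - q'‖ ^ 2) * C := by
  unfold locCost
  rw [← Finset.sum_sub_distrib, mul_assoc, ← nsmul_eq_mul]
  refine Finset.sum_le_card_nsmul _ _ _ fun q hq => ?_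
  rw [← mul_sub]
  refine (mul_le_mul_of_nonneg_left (hgh q hq)
    (Finset.le_inf' _ _ fun _ _ => sq_nonneg _)).trans (mul_le_mul_of_nonneg_right ?_ hC)
  exact (Finset.inf'_le (fun i => ‖q - x i‖ ^ 2) (Finset.mem_univ ⟨0, hn⟩)).trans
    ((Finset.le_sup' (fun q' => ‖q - q'‖ ^ 2) (hx ⟨0, hn⟩)).trans
      (Finset.le_sup' (fun q => Q.sup' hQ fun q' => ‖q - q'‖ ^ 2) hq))

/-- Per-step regret bound (from the proof of Theorem 1): if `f̂ ≤ f ≤ f̂ + 2b·s` on `Q`,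
`s ≥ 0` on `Q`, and `x̂ ∈ Qⁿ` minimizes the locational cost of `f̂` over `Qⁿ`, then for every
`x* ∈ Qⁿ`, `ℓ(f, x̂) − ℓ(f, x*) ≤ 2·b·c₀·max_{q∈Q} s(q)` with
`c₀ = |Q|·max_{q,q'∈Q} ‖q−q'‖²`. -/
theorem per_step_regret_bound {n : ℕ} (hn : 0 < n)
    (Q : Finset (EuclideanSpace ℝ (Fin 2))) (hQ : Q.Nonempty)
    (f fhat s : EuclideanSpace ℝ (Fin 2) → ℝ)
    (hs : ∀ q ∈ Q, 0 ≤ s q) (b : ℝ) (hb : 0 ≤ b)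
    (hsandwich : ∀ q ∈ Q, fhat q ≤ f q ∧ f q ≤ fhat q + 2 * b * s q)
    (xhat : Fin n → EuclideanSpace ℝ (Fin 2)) (hxhat : ∀ i, xhat i ∈ Q)
    (hmin : ∀ y : Fin n → EuclideanSpace ℝ (Fin 2), (∀ i, y i ∈ Q) →
      locCost hn Q fhat xhat ≤ locCost hn Q fhat y)
    (xstar : Fin n → EuclideanSpace ℝ (Fin 2)) (hxstar : ∀ i, xstar i ∈ Q) :
    locCost hn Q f xhat - locCost hn Q f xstar
      ≤ 2 * b * ((Q.card : ℝ) * Q.sup' hQ (fun q => Q.sup' hQ fun q' => ‖q - q'‖ ^ 2))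
        * Q.sup' hQ s := by
  have hsup : 0 ≤ Q.sup' hQ s :=
    (hs _ hQ.choose_spec).trans (Finset.le_sup' s hQ.choose_spec)
  have hgap : ∀ q ∈ Q, f q - fhat q ≤ 2 * b * Q.sup' hQ s := fun q hq => by
    have := mul_le_mul_of_nonneg_left (Finset.le_sup' s hq) (by positivity : 0 ≤ 2 * b)
    linarith [(hsandwich q hq).2]
  have hoptimism := locCost_mono_density hn Q (fun q hq => (hsandwich q hq).1) xstar
  have hdiff := locCost_sub_le hn Q hQ (by positivity) hgap hxhat
  linarith [hmin xstar hxstar]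
end

section
/- Let m, T ≥ 1, s > 0, c ≥ 0, and let p be the m-fold product of Gaussian measures N(0, s²) on ℝ^m. Let φ_1, …, φ_T ∈ ℝ^m with ‖φ_t‖ ≤ 1, and for each t let L_t : ℝ → ℝ be a nonnegative twice-differentiable function with |L_t''(z)| ≤ c for all z. Then for every θ* ∈ ℝ^m: −log ∫_{ℝ^m} exp(−Σ_{t=1}^T L_t(⟨φ_t, θ⟩)) dp(θ) ≤ Σ_{t=1}^T L_t(⟨φ_t, θ*⟩) + ‖θ*‖²/(2s²) + (m/2)·log(1 + T·c·s²/m). -/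
open MeasureTheory ProbabilityTheory
open scoped BigOperators

/-- A product of probability measures with densities has the product density. -/
lemma pi_withDensity_eq {ι : Type*} [Fintype ι] {X : ι → Type*} [∀ i, MeasurableSpace (X i)]
    (μ : ∀ i, Measure (X i)) [∀ i, IsProbabilityMeasure (μ i)]
    (f : ∀ i, X i → ENNReal) (hf : ∀ i, Measurable (f i))
    [∀ i, SigmaFinite ((μ i).withDensity (f i))] :
    Measure.pi (fun i => (μ i).withDensity (f i))
      = (Measure.pi μ).withDensity (fun x => ∏ i, f i (x i)) := by
  refine Measure.pi_eq fun S hS => ?_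
  have hfS : ∀ i, Measurable ((S i).indicator (f i)) := fun i => (hf i).indicator (hS i)
  have hind : ∀ x : ∀ i, X i, (Set.univ.pi S).indicator (fun x => ∏ i, f i (x i)) x
      = ∏ i, (S i).indicator (f i) (x i) := by
    intro x
    by_cases hx : x ∈ Set.univ.pi S
    · rw [Set.indicator_of_mem hx]
      exact Finset.prod_congr rfl fun i _ =>
        (Set.indicator_of_mem (hx i (Set.mem_univ i)) (f i)).symm
    · rw [Set.indicator_of_notMem hx]
      simp only [Set.mem_univ_pi, not_forall] at hx
      obtain ⟨i, hi⟩ := hx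
      exact (Finset.prod_eq_zero (Finset.mem_univ i) (Set.indicator_of_notMem hi (f i))).symm
  rw [withDensity_apply _ (MeasurableSet.univ_pi hS),
    ← lintegral_indicator (MeasurableSet.univ_pi hS), lintegral_congr hind,
    lintegral_prod_eq_prod_lintegral_of_indepFun Finset.univ
      (fun i (x : ∀ i, X i) => (S i).indicator (f i) (x i))
      (iIndepFun_pi fun i => (hfS i).aemeasurable)
      fun i => (hfS i).comp (measurable_pi_apply i)]
  refine Finset.prod_congr rfl fun i _ => ?_
  rw [(measurePreserving_eval μ i).lintegral_comp (hfS i), lintegral_indicator (hS i),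
    withDensity_apply _ (hS i)]

/-- The log-density of `N(a, v)` with respect to `N(b, w)`. -/
noncomputable def gaussianLogRatio (a b v w x : ℝ) : ℝ :=
  Real.log (w / v) / 2 - (x - a) ^ 2 / (2 * v) + (x - b) ^ 2 / (2 * w)

@[fun_prop]
lemma measurable_gaussianLogRatio (a b v w : ℝ) : Measurable (gaussianLogRatio a b v w) := by
  unfold gaussianLogRatio
  fun_prop

lemma gaussianReal_eq_withDensity_gaussianReal (a b : ℝ) {v w : NNReal} (hv : v ≠ 0)
    (hw : w ≠ 0) :
    gaussianReal a v = (gaussianReal b w).withDensity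
      (fun x => ENNReal.ofReal (Real.exp (gaussianLogRatio a b v w x))) := by
  rw [gaussianReal_of_var_ne_zero _ hv, gaussianReal_of_var_ne_zero _ hw,
    ← withDensity_mul _ (measurable_gaussianPDF b w) (by fun_prop)]
  congr 1
  ext x
  have hv' : (0 : ℝ) < v := NNReal.coe_pos.2 (pos_iff_ne_zero.2 hv)
  have hw' : (0 : ℝ) < w := NNReal.coe_pos.2 (pos_iff_ne_zero.2 hw)
  rw [Pi.mul_apply, gaussianPDF, gaussianPDF, ← ENNReal.ofReal_mul (gaussianPDFReal_nonneg _ _ _)]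
  congr 1
  have hsqrt : Real.exp (Real.log (w / v) / 2) = √w / √v := by
    rw [← Real.sqrt_div hw'.le, Real.sqrt_eq_rpow, Real.rpow_def_of_pos (by positivity)]
    ring_nf
  have h2 : Real.exp (gaussianLogRatio a b v w x) = √w / √v
      * Real.exp (-(x - a) ^ 2 / (2 * v)) * Real.exp ((x - b) ^ 2 / (2 * w)) := by
    rw [← hsqrt, ← Real.exp_add, ← Real.exp_add, gaussianLogRatio]
    ring_nf
  rw [gaussianPDFReal, gaussianPDFReal, h2, Real.sqrt_mul (by positivity) (v : ℝ),
    Real.sqrt_mul (by positivity) (w : ℝ)]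
  have hv'' : 0 < √(v : ℝ) := Real.sqrt_pos.2 hv'
  have hw'' : 0 < √(w : ℝ) := Real.sqrt_pos.2 hw'
  have hpi : 0 < √(2 * Real.pi) := by positivity
  field_simp
  rw [← Real.exp_add, neg_add_cancel, Real.exp_zero]

lemma pi_gaussianReal_eq_withDensity {ι : Type*} [Fintype ι] (a b : ι → ℝ) {v w : NNReal}
    (hv : v ≠ 0) (hw : w ≠ 0) :
    Measure.pi (fun i => gaussianReal (a i) v)
      = (Measure.pi fun i => gaussianReal (b i) w).withDensity
        (fun x => ENNReal.ofReal (Real.exp (∑ i, gaussianLogRatio (a i) (b i) v w (x i)))) := by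
  have h := fun i => gaussianReal_eq_withDensity_gaussianReal (a i) (b i) hv hw
  have : ∀ i, SigmaFinite ((gaussianReal (b i) w).withDensity
      (fun x => ENNReal.ofReal (Real.exp (gaussianLogRatio (a i) (b i) v w x)))) := fun i => by
    rw [← h i]; infer_instance
  rw [funext h, pi_withDensity_eq _ _ fun i => by fun_prop]
  congr 1
  ext x
  rw [Real.exp_sum, ENNReal.ofReal_prod_of_nonneg fun i _ => (Real.exp_pos _).le]

/-- The compression inequality `-log ∫ exp (-g) dp ≤ E_q[h] + KL(q ‖ p)` for `g ≤ h`, where `l` is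
the log-density of `p` with respect to `q`. -/
lemma neg_log_integral_exp_neg_le {Ω : Type*} [MeasurableSpace Ω] {p q : Measure Ω}
    [IsProbabilityMeasure q] {l g h : Ω → ℝ} (hl : Measurable l)
    (hp : p = q.withDensity fun x => ENNReal.ofReal (Real.exp (l x)))
    (hg : Integrable (fun x => Real.exp (-g x)) p) (hgh : ∀ x, g x ≤ h x)
    (hl_int : Integrable l q) (hh_int : Integrable h q) :
    -Real.log (∫ x, Real.exp (-g x) ∂p) ≤ ∫ x, h x ∂q - ∫ x, l x ∂q := by
  have hmeas : Measurable fun x => ENNReal.ofReal (Real.exp (l x)) := by fun_prop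
  have htop : ∀ᵐ x ∂q, ENNReal.ofReal (Real.exp (l x)) < ⊤ := by simp
  rw [hp, integrable_withDensity_iff_integrable_smul' hmeas htop] at hg
  rw [hp, integral_withDensity_eq_integral_toReal_smul hmeas htop]
  simp only [ENNReal.toReal_ofReal (Real.exp_pos _).le, smul_eq_mul] at hg ⊢
  set A : ℝ := ∫ x, l x ∂q - ∫ x, h x ∂q with hA
  have hint : Integrable (fun x => l x - h x) q := hl_int.sub hh_int
  have hlin : Integrable (fun x => Real.exp A * (1 - A + (l x - h x))) q :=
    ((integrable_const _).add hint).const_mul _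
  have hval : ∫ x, Real.exp A * (1 - A + (l x - h x)) ∂q = Real.exp A := by
    rw [integral_const_mul, integral_add (integrable_const _) hint, integral_sub hl_int hh_int]
    simp [hA]
  have hle : Real.exp A ≤ ∫ x, Real.exp (l x) * Real.exp (-g x) ∂q := by
    rw [← hval]
    refine integral_mono hlin hg fun x => ?_
    have h1 := Real.add_one_le_exp (l x - h x - A)
    calc Real.exp A * (1 - A + (l x - h x))
        ≤ Real.exp A * Real.exp (l x - h x - A) := by gcongr; linarith
      _ = Real.exp (l x - h x) := by rw [← Real.exp_add]; ring_nf
      _ ≤ Real.exp (l x) * Real.exp (-g x) := by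
        rw [← Real.exp_add]; gcongr; linarith [hgh x]
  have := (Real.le_log_iff_exp_le ((Real.exp_pos A).trans_le hle)).2 hle
  linarith

lemma le_quadratic_of_second_deriv_le {f f' f'' : ℝ → ℝ} {c : ℝ}
    (hf : ∀ z, HasDerivAt f (f' z) z) (hf' : ∀ z, HasDerivAt f' (f'' z) z)
    (hc : ∀ z, f'' z ≤ c) (a z : ℝ) :
    f z ≤ f a + f' a * (z - a) + c / 2 * (z - a) ^ 2 := by
  set G : ℝ → ℝ := fun z => f a + f' a * (z - a) + c / 2 * (z - a) ^ 2 - f z with hG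
  set G' : ℝ → ℝ := fun z => f' a + c * (z - a) - f' z with hG'
  have hsub : ∀ z, HasDerivAt (fun z => z - a) 1 z := fun z => (hasDerivAt_id z).sub_const a
  have dG : ∀ z, HasDerivAt G (G' z) z := fun z => by
    have := ((((hsub z).const_mul (f' a)).const_add (f a)).add
      (((hsub z).pow 2).const_mul (c / 2))).sub (hf z)
    refine this.congr_deriv ?_
    simp only [hG']
    push_cast
    ring
  have dG' : ∀ z, HasDerivAt G' (c - f'' z) z := fun z => by
    have := (((hsub z).const_mul c).const_add (f' a)).sub (hf' z)
    exact this.congr_deriv (by ring)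
  have hmono : Monotone G' := monotone_of_hasDerivAt_nonneg dG' fun z => sub_nonneg.2 (hc z)
  have hG'a : G' a = 0 := by simp [hG']
  have hGa : G a = 0 := by simp [hG]
  have hcont : Continuous G := continuous_iff_continuousAt.2 fun z => (dG z).continuousAt
  have key : 0 ≤ G z := by
    rw [← hGa]
    rcases le_total a z with h | h
    · refine monotoneOn_of_hasDerivWithinAt_nonneg (convex_Ici a) hcont.continuousOn
        (fun x _ => (dG x).hasDerivWithinAt) (fun x hx => ?_) Set.self_mem_Ici h h
      rw [interior_Ici] at hx
      exact hG'a ▸ hmono hx.le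
    · refine antitoneOn_of_hasDerivWithinAt_nonpos (convex_Iic a) hcont.continuousOn
        (fun x _ => (dG x).hasDerivWithinAt) (fun x hx => ?_) h Set.self_mem_Iic h
      rw [interior_Iic] at hx
      exact hG'a ▸ hmono hx.le
  simp only [hG] at key
  linarith

lemma integrable_sub_sq_gaussianReal (a b : ℝ) (v : NNReal) :
    Integrable (fun x => (x - a) ^ 2) (gaussianReal b v) :=
  ((memLp_id_gaussianReal 2).sub (memLp_const a)).integrable_sq

lemma integral_sub_gaussianReal (a b : ℝ) (v : NNReal) :
    ∫ x, (x - a) ∂gaussianReal b v = b - a := by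
  have hint : Integrable (fun x => x) (gaussianReal b v) :=
    (memLp_id_gaussianReal 1).integrable le_rfl
  rw [integral_sub hint (integrable_const a)]
  simp

lemma integral_sub_sq_gaussianReal (a b : ℝ) (v : NNReal) :
    ∫ x, (x - a) ^ 2 ∂gaussianReal b v = v + (b - a) ^ 2 := by
  have h := variance_eq_sub
    ((memLp_id_gaussianReal (μ := b) (v := v) 2).sub (memLp_const a))
  have hvar : Var[fun x => x - a; gaussianReal b v] = v := by
    rw [variance_sub_const (X := fun x => x) aestronglyMeasurable_id,
      variance_fun_id_gaussianReal]
  change Var[fun x => x - a; gaussianReal b v]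
    = ∫ x, (x - a) ^ 2 ∂gaussianReal b v - (∫ x, (x - a) ∂gaussianReal b v) ^ 2 at h
  rw [hvar, integral_sub_gaussianReal] at h
  linarith

lemma integrable_gaussianLogRatio (a b : ℝ) (v w : NNReal) :
    Integrable (gaussianLogRatio a b v w) (gaussianReal b w) :=
  ((integrable_const _).sub ((integrable_sub_sq_gaussianReal a b w).div_const _)).add
    ((integrable_sub_sq_gaussianReal b b w).div_const _)

/-- The Kullback–Leibler divergence of `N(b, w)` from `N(a, v)`, up to sign. -/
lemma integral_gaussianLogRatio (a b : ℝ) {v w : NNReal} (hw : w ≠ 0) :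
    ∫ x, gaussianLogRatio a b v w x ∂gaussianReal b w
      = Real.log (w / v) / 2 - (w + (b - a) ^ 2) / (2 * v) + 1 / 2 := by
  have hw' : (w : ℝ) ≠ 0 := NNReal.coe_ne_zero.2 hw
  have hquad := (integrable_sub_sq_gaussianReal a b w).div_const (2 * (v : ℝ))
  have hdiff : Integrable (fun x => Real.log ((w : ℝ) / v) / 2 - (x - a) ^ 2 / (2 * v))
      (gaussianReal b w) := (integrable_const _).sub hquad
  unfold gaussianLogRatio
  rw [integral_add hdiff ((integrable_sub_sq_gaussianReal b b w).div_const _),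
    integral_sub (integrable_const _) hquad,
    integral_const, integral_div, integral_div, integral_sub_sq_gaussianReal,
    integral_sub_sq_gaussianReal]
  simp
  field_simp

section LinearForm

variable {ι : Type*} [Fintype ι] (u b : ι → ℝ) (w : NNReal)

lemma memLp_linearForm_pi_gaussianReal :
    MemLp (fun x : ι → ℝ => ∑ i, u i * (x i - b i)) 2
      (Measure.pi fun i => gaussianReal (b i) w) :=
  memLp_finsetSum _ fun i _ =>
    (((memLp_id_gaussianReal 2).sub (memLp_const (b i))).const_mul (u i)).comp_measurePreserving
      (measurePreserving_eval (fun i => gaussianReal (b i) w) i)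

lemma integral_linearForm_pi_gaussianReal :
    ∫ x : ι → ℝ, ∑ i, u i * (x i - b i) ∂(Measure.pi fun i => gaussianReal (b i) w) = 0 := by
  have hint : ∀ i, Integrable (fun x => u i * (x - b i)) (gaussianReal (b i) w) := fun i =>
    (((memLp_id_gaussianReal 1).integrable le_rfl).sub (integrable_const (b i))).const_mul (u i)
  have hint_pi : ∀ i, Integrable (fun x : ι → ℝ => u i * (x i - b i))
      (Measure.pi fun i => gaussianReal (b i) w) := fun i =>
    integrable_comp_eval (μ := fun i => gaussianReal (b i) w)
      (f := fun x => u i * (x - b i)) (hint i)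
  rw [integral_finsetSum _ fun i _ => hint_pi i]
  refine Finset.sum_eq_zero fun i _ => ?_
  rw [integral_comp_eval (μ := fun i => gaussianReal (b i) w)
    (f := fun x => u i * (x - b i)) (hint i).aestronglyMeasurable, integral_const_mul,
    integral_sub_gaussianReal, sub_self, mul_zero]

lemma integral_linearForm_sq_pi_gaussianReal :
    ∫ x : ι → ℝ, (∑ i, u i * (x i - b i)) ^ 2 ∂(Measure.pi fun i => gaussianReal (b i) w)
      = w * ∑ i, u i ^ 2 := by
  have hL : ∀ i, MemLp (fun x => u i * (x - b i)) 2 (gaussianReal (b i) w) := fun i =>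
    ((memLp_id_gaussianReal 2).sub (memLp_const (b i))).const_mul (u i)
  have hvar := variance_sum_pi hL
  have hfun : (∑ i, fun x : ι → ℝ => u i * (x i - b i)) = fun x => ∑ i, u i * (x i - b i) := by
    ext x; simp
  rw [hfun, variance_of_integral_eq_zero (memLp_linearForm_pi_gaussianReal u b w).aemeasurable
    (integral_linearForm_pi_gaussianReal u b w)] at hvar
  rw [hvar, Finset.mul_sum]
  refine Finset.sum_congr rfl fun i _ => ?_
  rw [variance_const_mul, variance_sub_const (X := fun x => x) aestronglyMeasurable_id,
    variance_fun_id_gaussianReal, mul_comm]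

end LinearForm

/-- Lemma 2 of Appendix D: with a Gaussian prior `p = ⨂ᵢ N(0, s²)` on `ℝ^m`, unit-norm
feature vectors `φ_t` and nonnegative losses `L_t` with `|L_t''| ≤ c`, the Gaussian-prior
marginal likelihood satisfies, for every `θ* ∈ ℝ^m`,
`−log ∫ exp(−Σ_t L_t(⟨φ_t,θ⟩)) dp(θ) ≤ Σ_t L_t(⟨φ_t,θ*⟩) + ‖θ*‖²/(2s²) + (m/2)·log(1 + Tcs²/m)`. -/
theorem bayesian_loss_bound {m T : ℕ} (hm : 0 < m) (hT : 0 < T)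
    (s : ℝ) (hs : 0 < s) (c : ℝ) (hc : 0 ≤ c)
    (p : Measure (Fin m → ℝ))
    (hp : p = Measure.pi fun _ : Fin m => gaussianReal 0 (⟨s ^ 2, sq_nonneg _⟩ : NNReal))
    (φ : Fin T → EuclideanSpace ℝ (Fin m)) (hφ : ∀ t, ‖φ t‖ ≤ 1)
    (L : Fin T → ℝ → ℝ) (hL0 : ∀ t z, 0 ≤ L t z)
    (L' L'' : Fin T → ℝ → ℝ)
    (hL' : ∀ t z, HasDerivAt (L t) (L' t z) z)
    (hL'' : ∀ t z, HasDerivAt (L' t) (L'' t z) z)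
    (hLc : ∀ t z, |L'' t z| ≤ c)
    (θstar : EuclideanSpace ℝ (Fin m)) :
    -Real.log (∫ θ, Real.exp (-∑ t : Fin T, L t (∑ i, φ t i * θ i)) ∂p)
      ≤ (∑ t : Fin T, L t (∑ i, φ t i * θstar i))
        + ‖θstar‖ ^ 2 / (2 * s ^ 2)
        + (m / 2 : ℝ) * Real.log (1 + T * c * s ^ 2 / m) := by
  have hm' : (0 : ℝ) < m := Nat.cast_pos.2 hm
  set v : NNReal := ⟨s ^ 2, sq_nonneg _⟩ with hv_def
  have hvs : (v : ℝ) = s ^ 2 := rfl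
  have hv : v ≠ 0 := by
    rw [← NNReal.coe_ne_zero, hvs]; positivity
  have hK : 0 < 1 + T * c * s ^ 2 / m := by positivity
  set K : ℝ := 1 + T * c * s ^ 2 / m with hK_def
  set w : NNReal := ⟨s ^ 2 / K, by positivity⟩ with hw_def
  have hws : (w : ℝ) = s ^ 2 / K := rfl
  have hw : w ≠ 0 := by
    rw [← NNReal.coe_ne_zero, hws]; positivity
  set q : Measure (Fin m → ℝ) := Measure.pi fun i => gaussianReal (θstar i) w with hq
  set l : (Fin m → ℝ) → ℝ := fun x => ∑ i, gaussianLogRatio 0 (θstar i) v w (x i) with hl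
  set D : Fin T → (Fin m → ℝ) → ℝ := fun t x => ∑ i, φ t i * (x i - θstar i) with hD
  set z : Fin T → ℝ := fun t => ∑ i, φ t i * θstar i with hz
  set h : (Fin m → ℝ) → ℝ := fun x =>
    ∑ t, (L t (z t) + L' t (z t) * D t x + c / 2 * D t x ^ 2) with hh
  have hpq : p = q.withDensity fun x => ENNReal.ofReal (Real.exp (l x)) := by
    rw [hp]; exact pi_gaussianReal_eq_withDensity (fun _ => 0) θstar hv hw
  have hprob : IsProbabilityMeasure p := by rw [hp]; infer_instance
  have hLcont : ∀ t, Continuous (L t) := fun t =>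
    continuous_iff_continuousAt.2 fun z => (hL' t z).continuousAt
  have hg_int : Integrable
      (fun θ : Fin m → ℝ => Real.exp (-∑ t : Fin T, L t (∑ i, φ t i * θ i))) p := by
    refine Integrable.of_bound (Continuous.aestronglyMeasurable (by fun_prop)) 1
      (Filter.Eventually.of_forall fun θ => ?_)
    rw [Real.norm_eq_abs, Real.abs_exp, Real.exp_le_one_iff, neg_nonpos]
    exact Finset.sum_nonneg fun t _ => hL0 t _
  have hgh : ∀ θ : Fin m → ℝ, ∑ t : Fin T, L t (∑ i, φ t i * θ i) ≤ h θ := fun θ => by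
    refine Finset.sum_le_sum fun t _ => ?_
    have hdiff : D t θ = ∑ i, φ t i * θ i - z t := by
      simp only [hD, hz, mul_sub, Finset.sum_sub_distrib]
    rw [hdiff]
    exact le_quadratic_of_second_deriv_le (hL' t) (hL'' t)
      (fun x => (le_abs_self _).trans (hLc t x)) _ _
  have hratio : ∀ i, Integrable (fun x : Fin m → ℝ => gaussianLogRatio 0 (θstar i) v w (x i)) q :=
    fun i => integrable_comp_eval (integrable_gaussianLogRatio 0 (θstar i) v w)
  have hl_int : Integrable l q := integrable_finsetSum _ fun i _ => hratio i
  have hD_Lp : ∀ t, MemLp (D t) 2 q := fun t =>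
    memLp_linearForm_pi_gaussianReal (φ t) θstar w
  have hD_int : ∀ t, Integrable (D t) q := fun t => (hD_Lp t).integrable one_le_two
  have hterm : ∀ t, Integrable (fun x => L t (z t) + L' t (z t) * D t x) q := fun t =>
    (integrable_const _).add ((hD_int t).const_mul _)
  have hsq : ∀ t, Integrable (fun x => c / 2 * D t x ^ 2) q := fun t =>
    (hD_Lp t).integrable_sq.const_mul _
  have hquad : ∀ t, Integrable (fun x => L t (z t) + L' t (z t) * D t x + c / 2 * D t x ^ 2) q :=
    fun t => (hterm t).add (hsq t)
  have hh_int : Integrable h q := integrable_finsetSum _ fun t _ => hquad t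
  have hbound := neg_log_integral_exp_neg_le (by fun_prop) hpq hg_int hgh hl_int hh_int
  have hl_val : ∫ x, l x ∂q
      = -(m / 2 * Real.log K) - m / (2 * K) - ‖θstar‖ ^ 2 / (2 * s ^ 2) + m / 2 := by
    have hlog : Real.log ((w : ℝ) / v) = -Real.log K := by
      rw [hws, hvs, ← Real.log_inv]
      congr 1
      field_simp
    simp only [hl]
    rw [integral_finsetSum _ fun i _ => hratio i]
    have hval : ∀ i, ∫ x : Fin m → ℝ, gaussianLogRatio 0 (θstar i) v w (x i) ∂q
        = (-(Real.log K / 2) - 1 / (2 * K) + 1 / 2) - θstar i ^ 2 / (2 * s ^ 2) := fun i => by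
      rw [integral_comp_eval (μ := fun i => gaussianReal (θstar i) w)
        (integrable_gaussianLogRatio 0 (θstar i) v w).aestronglyMeasurable,
        integral_gaussianLogRatio 0 (θstar i) hw, hlog, hws, hvs]
      field_simp
      ring
    rw [Finset.sum_congr rfl fun i _ => hval i, Finset.sum_sub_distrib, ← Finset.sum_div,
      EuclideanSpace.real_norm_sq_eq, Finset.sum_const, Finset.card_univ, Fintype.card_fin,
      nsmul_eq_mul]
    field_simp
    ring
  have hh_le : ∫ x, h x ∂q ≤ ∑ t, L t (z t) + T * (c / 2 * (s ^ 2 / K)) := by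
    simp only [hh]
    rw [integral_finsetSum _ fun t _ => hquad t]
    calc ∑ t, ∫ x, (L t (z t) + L' t (z t) * D t x + c / 2 * D t x ^ 2) ∂q
        ≤ ∑ t, (L t (z t) + c / 2 * (s ^ 2 / K)) := Finset.sum_le_sum fun t _ => by
          have hnorm : ∑ i, φ t i ^ 2 ≤ 1 := by
            rw [← EuclideanSpace.real_norm_sq_eq]
            exact pow_le_one₀ (norm_nonneg _) (hφ t)
          rw [integral_add (hterm t) (hsq t),
            integral_add (integrable_const _) ((hD_int t).const_mul _),
            integral_const_mul, integral_const_mul,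
            integral_linearForm_pi_gaussianReal (φ t) θstar w,
            integral_linearForm_sq_pi_gaussianReal (φ t) θstar w, hws]
          have : s ^ 2 / K * ∑ i, φ t i ^ 2 ≤ s ^ 2 / K :=
            mul_le_of_le_one_right (by positivity) hnorm
          simp only [integral_const, probReal_univ, one_smul, mul_zero, add_zero]
          gcongr
      _ = ∑ t, L t (z t) + T * (c / 2 * (s ^ 2 / K)) := by
          simp [Finset.sum_add_distrib]
  have hcancel : T * (c / 2 * (s ^ 2 / K)) + m / (2 * K) = m / 2 := by
    have : T * c * s ^ 2 + m = m * K := by rw [hK_def]; field_simp; ring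
    field_simp
    linarith
  linarith
end
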